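/- (Generalisation error of gradient descent.) Let $d,m,n\ge 1$ be integers. Let $\phi:\mathbb R\to\mathbb R$ be twice differentiable with $|\phi|\le B_\phi$, $|\phi'|\le B_{\phi'}$, $|\phi''|\le B_{\phi''}$, let $u\in\{\pm 1/\sqrt m\}^m$ be fixed, and for $W\in\mathbb R^{d\times m}$ with columns $W_1,\dots,W_m$ put $f_W(x)=\sum_{k=1}^m u_k\,\phi(\langle W_k,x\rangle)$ and $\ell(W,(x,y))=\tfrac12(f_W(x)-y)^2$. Let $P$ be a probability distribution on $\mathbb R^d\times\mathbb R$ supported on $\{\|x\|_2\le C_x\}\times[-C_y,C_y]$, where $C_x,C_y>0$, and let $S=(z_1,\dots,z_n)$ be i.i.d. from $P$. Write $L_S(W)=\frac1n\sum_{i=1}^n\ell(W,z_i)$ and $L(W)=\mathbf E_{z\sim P}\,\ell(W,z)$. Fix $W_0\in\mathbb R^{d\times m}$ and $C_0>0$ with $\ell(W_0,z)\le C_0$ for $P$-almost every $z$, fix a step size $\eta>0$, and let $W_{s+1}=W_s-\eta\nabla L_S(W_s)$ for $s\ge 0$. Put $$\rho=C_x^2\Big(B_{\phi'}^2+B_{\phi''}B_\phi+\frac{B_{\phi''}C_y}{\sqrt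 m}\Big).$$ Let $t\ge 1$ be an integer. Suppose that $\eta\le 1/(2\rho)$ (no restriction if $\rho=0$) and $$m\ \ge\ 144\,(\eta t)^2\,C_x^4\,C_0\,B_{\phi''}^2\,\big(4B_{\phi'}C_x\sqrt{\eta t}+\sqrt2\big)^2 .$$ Then $$\mathbf E\big[L(W_{t+1})-L_S(W_{t+1})\big]\ \le\ b\Big(\frac{\eta}{n}+\frac{\eta^2t}{n^2}\Big)\sum_{j=0}^{t}\mathbf E\big[L_S(W_j)\big],\qquad b=16\,e^3\,C_x^2B_{\phi'}^2\big(1+C_x^2B_{\phi'}^2\big),$$ where the expectations are over the sample $S$. -/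

import Mathlib

open MeasureTheory

noncomputable section

/-- The parameter space of a width-`m` shallow network on `ℝ^d`: a `d × m` matrix `W` whose
`k`-th column is `W (k, ·)`, with the Euclidean (= Frobenius) norm. -/
abbrev Param (d m : ℕ) : Type := EuclideanSpace ℝ (Fin m × Fin d)

/-- Inputs live in `ℝ^d` with the Euclidean norm. -/
abbrev Input (d : ℕ) : Type := EuclideanSpace ℝ (Fin d)

/-- Shallow network `f_W(x) = ∑ₖ uₖ φ(⟨Wₖ, x⟩)`. -/
def nnet {d m : ℕ} (φ : ℝ → ℝ) (u : Fin m → ℝ) (W : Param d m) (x : Input d) : ℝ :=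
  ∑ k : Fin m, u k * φ (∑ j : Fin d, W (k, j) * x j)

/-- Squared loss `ℓ(W, (x, y)) = (f_W(x) − y)² / 2`. -/
def sqLoss {d m : ℕ} (φ : ℝ → ℝ) (u : Fin m → ℝ) (W : Param d m) (z : Input d × ℝ) : ℝ :=
  (nnet φ u W z.1 - z.2) ^ 2 / 2

/-- Empirical risk `L_S(W) = (1/n) ∑ᵢ ℓ(W, zᵢ)`. -/
def empRisk {d m n : ℕ} (φ : ℝ → ℝ) (u : Fin m → ℝ) (S : Fin n → Input d × ℝ)
    (W : Param d m) : ℝ :=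
  (∑ i : Fin n, sqLoss φ u W (S i)) / n

/-- Population risk `L(W) = E_{z ∼ P} ℓ(W, z)`. -/
def popRisk {d m : ℕ} (φ : ℝ → ℝ) (u : Fin m → ℝ) (P : Measure (Input d × ℝ))
    (W : Param d m) : ℝ :=
  ∫ z, sqLoss φ u W z ∂P

/-- Gradient-descent iterates `W_{s+1} = W_s − η ∇L(W_s)` started at `W0`. -/
def gdIter {d m : ℕ} (η : ℝ) (L : Param d m → ℝ) (W0 : Param d m) : ℕ → Param d m
  | 0 => W0
  | s + 1 => gdIter η L W0 s - η • gradient L (gdIter η L W0 s)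

end

/-- Residual `r` with gradient field `g`: quantitative regularity needed for least-squares gradient
descent. -/
structure IsRegularResidual {E : Type*} [NormedAddCommGroup E] [InnerProductSpace ℝ E]
    (G β κ : ℝ) (r : E → ℝ) (g : E → E) : Prop where
  norm_grad_le : ∀ W, ‖g W‖ ≤ G
  taylor : ∀ W V, |r W - r V - inner ℝ (g V) (W - V)| ≤ β * ‖W - V‖ ^ 2
  grad_lipschitz : ∀ W V, ‖g W - g V‖ ≤ β * ‖W - V‖
  lipschitz : ∀ W V, |r W - r V| ≤ G * ‖W - V‖
  abs_mul_le : ∀ W, |r W| * β ≤ κ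

/-- The mean half squared residual. -/
noncomputable def lsqRisk {X : Type*} {n : ℕ} (r : Fin n → X → ℝ) (W : X) : ℝ := (∑ i, r i W ^ 2 / 2) / n

theorem lsqRisk_nonneg {X : Type*} {n : ℕ} (r : Fin n → X → ℝ) (W : X) : 0 ≤ lsqRisk r W := by
  unfold lsqRisk; positivity

section LeastSquares

variable {E : Type*} [NormedAddCommGroup E] [InnerProductSpace ℝ E] {G β κ : ℝ}

theorem IsRegularResidual.nonneg {r : E → ℝ} {g : E → E} (h : IsRegularResidual G β κ r g) :
    0 ≤ G := (norm_nonneg _).trans (h.norm_grad_le 0)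

theorem IsRegularResidual.half_sq_le {r : E → ℝ} {g : E → E} (h : IsRegularResidual G β κ r g)
    (W V : E) :
    r V ^ 2 / 2 ≤ r W ^ 2 / 2 + inner ℝ (r W • g W) (V - W) + (G ^ 2 + κ) * ‖V - W‖ ^ 2 := by
  have h1 := h.taylor V W
  have h2 := h.lipschitz V W
  have h3 := h.abs_mul_le W
  have h4 : (r V - r W) ^ 2 ≤ G ^ 2 * ‖V - W‖ ^ 2 := by
    rw [← mul_pow, ← sq_abs]
    exact pow_le_pow_left₀ (abs_nonneg _) h2 2
  have h5 : r W * (r V - r W - inner ℝ (g W) (V - W)) ≤ κ * ‖V - W‖ ^ 2 := by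
    calc _ ≤ |r W * (r V - r W - inner ℝ (g W) (V - W))| := le_abs_self _
      _ = |r W| * |r V - r W - inner ℝ (g W) (V - W)| := abs_mul _ _
      _ ≤ |r W| * (β * ‖V - W‖ ^ 2) := by gcongr
      _ = |r W| * β * ‖V - W‖ ^ 2 := by ring
      _ ≤ _ := by gcongr
  rw [real_inner_smul_left]
  have h6 : 0 ≤ G ^ 2 * ‖V - W‖ ^ 2 := by positivity
  linarith

/-- One gradient step on the mean half squared residual. -/
noncomputable def lsqStep {n : ℕ} (η : ℝ) (r : Fin n → E → ℝ) (g : Fin n → E → E) (W : E) : E :=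
  W - η • ((n : ℝ)⁻¹ • ∑ i, r i W • g i W)

theorem lsqRisk_step_le {n : ℕ} (hn : 1 ≤ n) {η : ℝ} (hη0 : 0 < η)
    (hη : 2 * η * (G ^ 2 + κ) ≤ 1)
    {r : Fin n → E → ℝ} {g : Fin n → E → E} (h : ∀ i, IsRegularResidual G β κ (r i) (g i)) (W : E) :
    lsqRisk r (lsqStep η r g W) ≤
      lsqRisk r W - (2 * η)⁻¹ * ‖lsqStep η r g W - W‖ ^ 2 := by
  have hn' : (0 : ℝ) < n := by exact_mod_cast hn
  set V := lsqStep η r g W with hV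
  set D := (n : ℝ)⁻¹ • ∑ i, r i W • g i W with hD
  have hVW : V - W = -(η • D) := by rw [hV, lsqStep]; abel
  have hsum : lsqRisk r V ≤ lsqRisk r W + inner ℝ D (V - W) + (G ^ 2 + κ) * ‖V - W‖ ^ 2 := by
    have : ∑ i, r i V ^ 2 / 2 ≤ ∑ i, (r i W ^ 2 / 2 + inner ℝ (r i W • g i W) (V - W)
        + (G ^ 2 + κ) * ‖V - W‖ ^ 2) := Finset.sum_le_sum fun i _ => (h i).half_sq_le W V
    rw [Finset.sum_add_distrib, Finset.sum_add_distrib, ← sum_inner, Finset.sum_const,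
      Finset.card_univ, Fintype.card_fin, nsmul_eq_mul] at this
    have hin : inner ℝ D (V - W) = inner ℝ (∑ i, r i W • g i W) (V - W) / n := by
      rw [hD, real_inner_smul_left]; ring
    unfold lsqRisk
    rw [hin, ← add_div, div_add' _ _ _ hn'.ne']
    gcongr
    linarith
  have h1 : inner ℝ D (V - W) = -η⁻¹ * ‖V - W‖ ^ 2 := by
    rw [hVW, inner_neg_right, real_inner_smul_right, norm_neg, norm_smul, mul_pow,
      real_inner_self_eq_norm_sq, Real.norm_eq_abs, sq_abs]
    field_simp
  have h2 : (G ^ 2 + κ) ≤ (2 * η)⁻¹ := by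
    rw [← one_div, le_div_iff₀ (by positivity)]
    linarith
  have h3 : (G ^ 2 + κ) * ‖V - W‖ ^ 2 ≤ (2 * η)⁻¹ * ‖V - W‖ ^ 2 := by gcongr
  have h4 : η⁻¹ = 2 * (2 * η)⁻¹ := by field_simp
  rw [h1, h4] at hsum
  linarith

theorem norm_sub_init_sq_le {n : ℕ} (hn : 1 ≤ n) {η : ℝ} (hη0 : 0 < η)
    (hη : 2 * η * (G ^ 2 + κ) ≤ 1)
    {r : Fin n → E → ℝ} {g : Fin n → E → E} (h : ∀ i, IsRegularResidual G β κ (r i) (g i))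
    {w : ℕ → E} (hw : ∀ s, w (s + 1) = lsqStep η r g (w s)) (s : ℕ) :
    ‖w s - w 0‖ ^ 2 ≤ 2 * η * s * (lsqRisk r (w 0) - lsqRisk r (w s)) := by
  induction s with
  | zero => simp
  | succ s ih =>
    have h1 := lsqRisk_step_le hn hη0 hη h (w s)
    rw [← hw] at h1
    set a := ‖w s - w 0‖
    set c := ‖w (s + 1) - w s‖
    have htri : ‖w (s + 1) - w 0‖ ≤ c + a := by
      simpa using norm_sub_le_norm_sub_add_norm_sub (w (s+1)) (w s) (w 0)
    have hc : c ^ 2 ≤ 2 * η * (lsqRisk r (w s) - lsqRisk r (w (s + 1))) := by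
      have : (2 * η)⁻¹ * c ^ 2 ≤ lsqRisk r (w s) - lsqRisk r (w (s + 1)) := by linarith
      rwa [inv_mul_le_iff₀ (by positivity)] at this
    set p := lsqRisk r (w 0) - lsqRisk r (w s)
    set q := lsqRisk r (w s) - lsqRisk r (w (s + 1))
    have hpq : lsqRisk r (w 0) - lsqRisk r (w (s + 1)) = p + q := by simp [p, q]
    rw [hpq]
    have h5 : ‖w (s + 1) - w 0‖ ^ 2 ≤ (c + a) ^ 2 := by gcongr
    push_cast
    rcases Nat.eq_zero_or_pos s with rfl | hs
    · have ha : a = 0 := by simp [a]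
      have hp : p = 0 := by simp [p]
      rw [ha] at h5
      simp only [Nat.cast_zero, hp]
      nlinarith
    · have hs' : (0 : ℝ) < s := by exact_mod_cast hs
      have h6 : (c + a) ^ 2 ≤ (s + 1) * c ^ 2 + (s + 1) / s * a ^ 2 := by
        have : (s + 1) * c ^ 2 + (s + 1) / s * a ^ 2 - (c + a) ^ 2 = (s * c - a) ^ 2 / s := by
          field_simp; ring
        have h7 : 0 ≤ (s * c - a) ^ 2 / s := by positivity
        linarith
      have h8 : (s + 1) / s * a ^ 2 ≤ (s + 1) / s * (2 * η * s * p) := by gcongr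
      have h9 : ((s : ℝ) + 1) / s * (2 * η * s * p) = 2 * η * (s + 1) * p := by field_simp
      have h10 : ((s : ℝ) + 1) * c ^ 2 ≤ (s + 1) * (2 * η * q) := by gcongr
      linarith

theorem lsqRisk_antitone {n : ℕ} (hn : 1 ≤ n) {η : ℝ} (hη0 : 0 < η)
    (hη : 2 * η * (G ^ 2 + κ) ≤ 1)
    {r : Fin n → E → ℝ} {g : Fin n → E → E} (h : ∀ i, IsRegularResidual G β κ (r i) (g i))
    {w : ℕ → E} (hw : ∀ s, w (s + 1) = lsqStep η r g (w s)) :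
    Antitone fun s => lsqRisk r (w s) := by
  refine antitone_nat_of_succ_le fun s => ?_
  have h1 := lsqRisk_step_le hn hη0 hη h (w s)
  rw [← hw] at h1
  have : 0 ≤ (2 * η)⁻¹ * ‖w (s + 1) - w s‖ ^ 2 := by positivity
  linarith

/-- `I - (η/n) ∑ gᵢ gᵢᵀ` is nonexpansive. -/
theorem norm_sub_sum_rankOne_le {ι : Type*} (s : Finset ι) {n : ℕ} (hs : s.card ≤ n) {η : ℝ}
    (hη0 : 0 ≤ η) (hη : η * G ^ 2 ≤ 1) (g : ι → E) (hg : ∀ i ∈ s, ‖g i‖ ≤ G) (x : E) :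
    ‖x - η • ((n : ℝ)⁻¹ • ∑ i ∈ s, inner ℝ (g i) x • g i)‖ ≤ ‖x‖ := by
  set M := ∑ i ∈ s, inner ℝ (g i) x • g i with hM
  set q := ∑ i ∈ s, (inner ℝ (g i) x : ℝ) ^ 2 with hq
  have hq0 : 0 ≤ q := Finset.sum_nonneg fun i _ => sq_nonneg _
  have hin : inner ℝ x M = q := by
    rw [hM, inner_sum]
    refine Finset.sum_congr rfl fun i _ => ?_
    rw [real_inner_smul_right, real_inner_comm]; ring
  have hnorm : ‖M‖ ^ 2 ≤ n * G ^ 2 * q := by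
    have h1 : ‖M‖ ≤ (∑ i ∈ s, |(inner ℝ (g i) x : ℝ)|) * G := by
      rw [Finset.sum_mul]
      refine (norm_sum_le _ _).trans (Finset.sum_le_sum fun i hi => ?_)
      rw [norm_smul, Real.norm_eq_abs]
      gcongr
      exact hg i hi
    have h2 : (∑ i ∈ s, |(inner ℝ (g i) x : ℝ)|) ^ 2 ≤ s.card * q := by
      simpa [hq, sq_abs] using sq_sum_le_card_mul_sum_sq (s := s) (f := fun i => |(inner ℝ (g i) x : ℝ)|)
    have h3 : (s.card : ℝ) ≤ n := by exact_mod_cast hs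
    calc ‖M‖ ^ 2 ≤ ((∑ i ∈ s, |(inner ℝ (g i) x : ℝ)|) * G) ^ 2 := by gcongr
      _ = (∑ i ∈ s, |(inner ℝ (g i) x : ℝ)|) ^ 2 * G ^ 2 := by ring
      _ ≤ (s.card * q) * G ^ 2 := by gcongr
      _ ≤ (n * q) * G ^ 2 := by gcongr
      _ = _ := by ring
  refine (sq_le_sq₀ (norm_nonneg _) (norm_nonneg _)).mp ?_
  rw [norm_sub_sq_real, real_inner_smul_right, real_inner_smul_right, hin, norm_smul, norm_smul,
    Real.norm_of_nonneg hη0, norm_inv, Real.norm_natCast, mul_pow, mul_pow]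
  rcases Nat.eq_zero_or_pos n with rfl | hn
  · simp
  have hn' : (0 : ℝ) < n := by exact_mod_cast hn
  have h1 : η ^ 2 * ((n : ℝ)⁻¹ ^ 2 * ‖M‖ ^ 2) ≤ η ^ 2 * ((n : ℝ)⁻¹ ^ 2 * (n * G ^ 2 * q)) := by
    gcongr
  have h2 : η ^ 2 * ((n : ℝ)⁻¹ ^ 2 * (n * G ^ 2 * q)) = (η * G ^ 2) * (η * ((n : ℝ)⁻¹ * q)) := by
    field_simp
  have h3 : 0 ≤ η * ((n : ℝ)⁻¹ * q) := by positivity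
  have h4 : (η * G ^ 2) * (η * ((n : ℝ)⁻¹ * q)) ≤ η * ((n : ℝ)⁻¹ * q) :=
    mul_le_of_le_one_left h3 hη
  linarith

theorem norm_partialStep_sub_le {ι : Type*} (s : Finset ι) {n : ℕ} (hn : 1 ≤ n) (hs : s.card ≤ n)
    {η : ℝ} (hη0 : 0 ≤ η) (hη : η * G ^ 2 ≤ 1) (hβ : 0 ≤ β)
    {r : ι → E → ℝ} {g : ι → E → E} (h : ∀ i ∈ s, IsRegularResidual G β κ (r i) (g i))
    (W V : E) {e : ℝ} (he0 : 0 ≤ e) (he : ∀ i ∈ s, |r i W| + G * ‖W - V‖ ≤ e) :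
    ‖(W - V) - η • ((n : ℝ)⁻¹ • ∑ i ∈ s, (r i W • g i W - r i V • g i V))‖
      ≤ (1 + η * (β * e)) * ‖W - V‖ := by
  have hn' : (0 : ℝ) < n := by exact_mod_cast hn
  set x := W - V with hx
  have hsplit : ∀ i, r i W • g i W - r i V • g i V = (inner ℝ (g i V) x : ℝ) • g i V
      + ((r i W - r i V - inner ℝ (g i V) x) • g i V + r i W • (g i W - g i V)) := by
    intro i; module
  have herr : ∀ i ∈ s, ‖(r i W - r i V - inner ℝ (g i V) x) • g i V + r i W • (g i W - g i V)‖
      ≤ β * e * ‖x‖ := by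
    intro i hi
    calc _ ≤ |r i W - r i V - inner ℝ (g i V) x| * ‖g i V‖ + |r i W| * ‖g i W - g i V‖ := by
          refine (norm_add_le _ _).trans ?_
          rw [norm_smul, norm_smul, Real.norm_eq_abs, Real.norm_eq_abs]
      _ ≤ (β * ‖x‖ ^ 2) * G + |r i W| * (β * ‖x‖) := by
          gcongr
          · exact (h i hi).taylor W V
          · exact (h i hi).norm_grad_le V
          · exact (h i hi).grad_lipschitz W V
      _ = β * (|r i W| + G * ‖x‖) * ‖x‖ := by ring
      _ ≤ β * e * ‖x‖ := by gcongr; exact he i hi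
  simp only [hsplit, Finset.sum_add_distrib (f := fun i => (inner ℝ (g i V) x : ℝ) • g i V)]
  rw [smul_add, smul_add, ← sub_sub]
  refine (norm_sub_le _ _).trans ?_
  have h1 := norm_sub_sum_rankOne_le s hs hη0 hη (fun i => g i V)
    (fun i hi => (h i hi).norm_grad_le V) x
  have h2 : ‖∑ i ∈ s, ((r i W - r i V - inner ℝ (g i V) x) • g i V + r i W • (g i W - g i V))‖
      ≤ n * (β * e * ‖x‖) := by
    refine (norm_sum_le_of_le s herr).trans ?_
    rw [Finset.sum_const, nsmul_eq_mul]
    gcongr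
  have h3 : ‖η • ((n : ℝ)⁻¹ • ∑ i ∈ s,
      ((r i W - r i V - inner ℝ (g i V) x) • g i V + r i W • (g i W - g i V)))‖
      ≤ η * (β * e * ‖x‖) := by
    rw [norm_smul, norm_smul, Real.norm_of_nonneg hη0, norm_inv, Real.norm_natCast]
    refine mul_le_mul_of_nonneg_left ?_ hη0
    rwa [inv_mul_le_iff₀ hn']
  linarith

theorem norm_lsqStep_sub_le {n : ℕ} (hn : 1 ≤ n)
    {η : ℝ} (hη0 : 0 ≤ η) (hη : η * G ^ 2 ≤ 1) (hβ : 0 ≤ β)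
    {r r' : Fin n → E → ℝ} {g g' : Fin n → E → E}
    (h : ∀ i, IsRegularResidual G β κ (r i) (g i))
    (h' : ∀ i, IsRegularResidual G β κ (r' i) (g' i))
    (i : Fin n) (hr : ∀ j ≠ i, r' j = r j) (hg : ∀ j ≠ i, g' j = g j)
    (W V : E) {e : ℝ} (he : ∀ j, |r j W| + G * ‖W - V‖ ≤ e) :
    ‖lsqStep η r g W - lsqStep η r' g' V‖
      ≤ (1 + η * (β * e)) * ‖W - V‖ + η / n * G * (|r i W| + |r' i V|) := by
  have hn' : (0 : ℝ) < n := by exact_mod_cast hn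
  have hG := (h i).nonneg
  have he0 : 0 ≤ e := le_trans (by positivity) (he i)
  have h1 := norm_partialStep_sub_le (Finset.univ.erase i) hn
    ((Finset.card_le_univ _).trans (Fintype.card_fin n).le) hη0 hη hβ (fun j _ => h j) W V he0
    (fun j _ => he j)
  have hs : ∑ j, r j W • g j W - ∑ j, r' j V • g' j V
      = ∑ j ∈ Finset.univ.erase i, (r j W • g j W - r j V • g j V)
        + (r i W • g i W - r' i V • g' i V) := by
    rw [← Finset.sum_sub_distrib, ← Finset.sum_erase_add _ _ (Finset.mem_univ i)]
    congr 1
    refine Finset.sum_congr rfl fun j hj => ?_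
    rw [hr j (Finset.ne_of_mem_erase hj), hg j (Finset.ne_of_mem_erase hj)]
  have heq : lsqStep η r g W - lsqStep η r' g' V
      = ((W - V) - η • ((n : ℝ)⁻¹ • ∑ j ∈ Finset.univ.erase i, (r j W • g j W - r j V • g j V)))
        - η • ((n : ℝ)⁻¹ • (r i W • g i W - r' i V • g' i V)) := by
    rw [sub_sub, ← smul_add, ← smul_add, ← hs, lsqStep, lsqStep]
    module
  rw [heq]
  refine (norm_sub_le _ _).trans (add_le_add h1 ?_)
  rw [norm_smul, norm_smul, Real.norm_of_nonneg hη0, norm_inv, Real.norm_natCast]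
  have h2 : ‖r i W • g i W - r' i V • g' i V‖ ≤ G * (|r i W| + |r' i V|) := by
    refine (norm_sub_le _ _).trans ?_
    rw [norm_smul, norm_smul, Real.norm_eq_abs, Real.norm_eq_abs, mul_add, mul_comm G, mul_comm G]
    gcongr
    · exact (h i).norm_grad_le W
    · exact (h' i).norm_grad_le V
  calc η * ((n : ℝ)⁻¹ * ‖r i W • g i W - r' i V • g' i V‖)
      ≤ η * ((n : ℝ)⁻¹ * (G * (|r i W| + |r' i V|))) := by gcongr
    _ = _ := by ring

theorem le_pow_mul_sum_of_succ_le {D q : ℕ → ℝ} {c : ℝ} (hc : 0 ≤ c) {t : ℕ} (h0 : D 0 = 0)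
    (hq : ∀ s, 0 ≤ q s) (h : ∀ s ≤ t, D (s + 1) ≤ (1 + c) * D s + q s) :
    ∀ s ≤ t + 1, D s ≤ (1 + c) ^ s * ∑ j ∈ Finset.range s, q j := by
  intro s
  induction s with
  | zero => intro _; simp [h0]
  | succ s ih =>
    intro hs
    have h1 := h s (by omega)
    have h2 := ih (by omega)
    have h3 : (1 : ℝ) ≤ (1 + c) ^ (s + 1) := one_le_pow₀ (by linarith)
    have h4 : (1 + c) * D s ≤ (1 + c) * ((1 + c) ^ s * ∑ j ∈ Finset.range s, q j) := by gcongr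
    have h5 : q s ≤ (1 + c) ^ (s + 1) * q s := le_mul_of_one_le_left (hq s) h3
    rw [Finset.sum_range_succ, mul_add]
    calc _ ≤ _ := h1
      _ ≤ (1 + c) * ((1 + c) ^ s * ∑ j ∈ Finset.range s, q j) + (1 + c) ^ (s + 1) * q s :=
        add_le_add h4 h5
      _ = _ := by ring

theorem abs_residual_le_of_lsq {n : ℕ} (hn : 1 ≤ n) {η : ℝ} (hη0 : 0 < η)
    (hη : 2 * η * (G ^ 2 + κ) ≤ 1)
    {r : Fin n → E → ℝ} {g : Fin n → E → E} (h : ∀ i, IsRegularResidual G β κ (r i) (g i))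
    {w : ℕ → E} (hw : ∀ s, w (s + 1) = lsqStep η r g (w s)) {C0 : ℝ}
    (h0 : ∀ i, r i (w 0) ^ 2 / 2 ≤ C0) {s t : ℕ} (hst : s ≤ t) :
    ‖w s - w 0‖ ≤ √(2 * η * t * C0) ∧ ∀ i, |r i (w s)| ≤ √(2 * C0) + G * √(2 * η * t * C0) := by
  have hn' : (0 : ℝ) < n := by exact_mod_cast hn
  have hL0 : lsqRisk r (w 0) ≤ C0 := by
    unfold lsqRisk
    rw [div_le_iff₀ hn']
    refine (Finset.sum_le_card_nsmul _ _ C0 fun i _ => h0 i).trans (le_of_eq ?_)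
    simp [mul_comm]
  have hLs := lsqRisk_nonneg r (w s)
  have hst' : (s : ℝ) ≤ t := by exact_mod_cast hst
  have hd : ‖w s - w 0‖ ≤ √(2 * η * t * C0) := by
    refine Real.le_sqrt_of_sq_le ((norm_sub_init_sq_le hn hη0 hη h hw s).trans ?_)
    have : lsqRisk r (w 0) - lsqRisk r (w s) ≤ C0 := by linarith
    have hC : 0 ≤ C0 := (lsqRisk_nonneg r (w 0)).trans hL0
    calc _ ≤ 2 * η * s * C0 := by gcongr
      _ ≤ _ := by gcongr
  refine ⟨hd, fun i => ?_⟩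
  have h1 := (h i).lipschitz (w s) (w 0)
  have h2 : |r i (w 0)| ≤ √(2 * C0) := Real.abs_le_sqrt (by linarith [h0 i])
  have h3 : G * ‖w s - w 0‖ ≤ G * √(2 * η * t * C0) := by
    have := (h i).nonneg
    gcongr
  have h4 : |r i (w s)| ≤ |r i (w 0)| + |r i (w s) - r i (w 0)| := by
    simpa using abs_add_le (r i (w 0)) (r i (w s) - r i (w 0))
  linarith

/-- Replacing one data point changes the `(t+1)`-st iterate by at most a multiple of the residuals
along the two trajectories at the replaced point. -/
theorem norm_lsq_iterate_sub_le {n : ℕ} (hn : 1 ≤ n) {η : ℝ} (hη0 : 0 < η)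
    (hκ : 0 ≤ κ) (hη : 2 * η * (G ^ 2 + κ) ≤ 1) (hβ : 0 ≤ β)
    {r r' : Fin n → E → ℝ} {g g' : Fin n → E → E}
    (h : ∀ i, IsRegularResidual G β κ (r i) (g i))
    (h' : ∀ i, IsRegularResidual G β κ (r' i) (g' i))
    (i : Fin n) (hr : ∀ j ≠ i, r' j = r j) (hg : ∀ j ≠ i, g' j = g j)
    {w v : ℕ → E} (hw : ∀ s, w (s + 1) = lsqStep η r g (w s))
    (hv : ∀ s, v (s + 1) = lsqStep η r' g' (v s)) (hwv : w 0 = v 0) {C0 : ℝ}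
    (h0 : ∀ i, r i (w 0) ^ 2 / 2 ≤ C0) (h0' : ∀ i, r' i (w 0) ^ 2 / 2 ≤ C0)
    {t : ℕ} (ht : 0 < t)
    (hwidth : 2 * t * (η * (β * (√(2 * C0) + 3 * (G * √(2 * η * t * C0))))) ≤ 1) :
    ‖w (t + 1) - v (t + 1)‖ ≤
      Real.exp 1 * (η / n * G * ∑ j ∈ Finset.range (t + 1), (|r i (w j)| + |r' i (v j)|)) := by
  have hG := (h i).nonneg
  have ht' : (1 : ℝ) ≤ t := by exact_mod_cast ht
  set e := √(2 * C0) + 3 * (G * √(2 * η * t * C0)) with he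
  have he0 : 0 ≤ e := by positivity
  set c := η * (β * e) with hc
  have hc0 : 0 ≤ c := by positivity
  have hηG : η * G ^ 2 ≤ 1 := by
    have : 0 ≤ η * κ := by positivity
    have : 0 ≤ η * G ^ 2 := by positivity
    linarith
  have hrec : ∀ s ≤ t, ‖w (s + 1) - v (s + 1)‖ ≤
      (1 + c) * ‖w s - v s‖ + η / n * G * (|r i (w s)| + |r' i (v s)|) := by
    intro s hs
    rw [hw, hv]
    refine norm_lsqStep_sub_le hn hη0.le hηG hβ h h' i hr hg _ _ fun j => ?_
    obtain ⟨h1, h2⟩ := abs_residual_le_of_lsq hn hη0 hη h hw h0 hs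
    obtain ⟨h3, -⟩ := abs_residual_le_of_lsq hn hη0 hη h' hv (by rwa [← hwv]) hs
    have h4 : ‖w s - v s‖ ≤ √(2 * η * t * C0) + √(2 * η * t * C0) := by
      have h5 := norm_sub_le (w s - w 0) (v s - v 0)
      rw [← hwv, sub_sub_sub_cancel_right] at h5
      rw [← hwv] at h3
      linarith
    have h6 : G * ‖w s - v s‖ ≤ G * (√(2 * η * t * C0) + √(2 * η * t * C0)) := by gcongr
    rw [he]
    linarith [h2 j]
  have hmain := le_pow_mul_sum_of_succ_le (D := fun s => ‖w s - v s‖)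
    (q := fun s => η / n * G * (|r i (w s)| + |r' i (v s)|)) hc0 (by simp [hwv])
    (fun s => by positivity) hrec (t + 1) le_rfl
  rw [← Finset.mul_sum] at hmain
  refine hmain.trans ?_
  gcongr
  have h1 : (1 + c) ^ (t + 1) ≤ Real.exp ((t + 1 : ℕ) * c) := by
    rw [Real.exp_nat_mul]
    gcongr
    linarith [Real.add_one_le_exp c]
  refine h1.trans (Real.exp_le_exp.mpr ?_)
  push_cast
  nlinarith

/-- Loss gap at a replaced data point, in terms of the losses along the two trajectories. -/
theorem half_sq_sub_half_sq_le {a c D K G : ℝ} {t : ℕ} (p q : ℕ → ℝ) (hG : 0 ≤ G) (hK : 0 ≤ K)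
    (hac : |a - c| ≤ G * D)
    (hD : D ≤ K * (G * ∑ j ∈ Finset.range (t + 1), (|p j| + |q j|))) :
    a ^ 2 / 2 - c ^ 2 / 2 ≤ K * G ^ 2 * (2 * (t + 1) * (c ^ 2 / 2)
        + ∑ j ∈ Finset.range (t + 1), (p j ^ 2 / 2 + q j ^ 2 / 2))
      + 2 * (t + 1) * (K * G ^ 2) ^ 2
        * ∑ j ∈ Finset.range (t + 1), (p j ^ 2 / 2 + q j ^ 2 / 2) := by
  set Q := ∑ j ∈ Finset.range (t + 1), (|p j| + |q j|) with hQ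
  set T := ∑ j ∈ Finset.range (t + 1), (p j ^ 2 / 2 + q j ^ 2 / 2) with hS
  have hQ0 : 0 ≤ Q := by positivity
  have h1 : |a - c| ≤ K * G ^ 2 * Q := by
    calc _ ≤ G * D := hac
      _ ≤ G * (K * (G * Q)) := by gcongr
      _ = _ := by ring
  have h2 : |c| * Q ≤ 2 * (t + 1) * (c ^ 2 / 2) + T := by
    have : 2 * (t + 1) * (c ^ 2 / 2) + T
        = ∑ j ∈ Finset.range (t + 1), (c ^ 2 + (p j ^ 2 / 2 + q j ^ 2 / 2)) := by
      rw [Finset.sum_add_distrib, Finset.sum_const, Finset.card_range, nsmul_eq_mul]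
      push_cast; ring
    rw [this, hQ, Finset.mul_sum]
    refine Finset.sum_le_sum fun j _ => ?_
    nlinarith [sq_nonneg (|c| - |p j|), sq_nonneg (|c| - |q j|), sq_abs c, sq_abs (p j),
      sq_abs (q j)]
  have h3 : Q ^ 2 ≤ 4 * (t + 1) * T := by
    have h4 : Q ^ 2 ≤ (t + 1) * ∑ j ∈ Finset.range (t + 1), (|p j| + |q j|) ^ 2 := by
      simpa using sq_sum_le_card_mul_sum_sq (s := Finset.range (t + 1))
        (f := fun j => |p j| + |q j|)
    have h5 : ∑ j ∈ Finset.range (t + 1), (|p j| + |q j|) ^ 2 ≤ 4 * T := by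
      rw [hS, Finset.mul_sum]
      refine Finset.sum_le_sum fun j _ => ?_
      nlinarith [sq_nonneg (|p j| - |q j|), sq_abs (p j), sq_abs (q j)]
    calc _ ≤ _ := h4
      _ ≤ (t + 1) * (4 * T) := by gcongr
      _ = _ := by ring
  have h6 : c * (a - c) ≤ K * G ^ 2 * (|c| * Q) := by
    calc c * (a - c) ≤ |c| * |a - c| := (le_abs_self _).trans (abs_mul _ _).le
      _ ≤ |c| * (K * G ^ 2 * Q) := by gcongr
      _ = _ := by ring
  have h7 : (a - c) ^ 2 ≤ (K * G ^ 2) ^ 2 * Q ^ 2 := by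
    rw [← mul_pow, ← sq_abs]
    gcongr
  have h8 : K * G ^ 2 * (|c| * Q) ≤ K * G ^ 2 * (2 * (t + 1) * (c ^ 2 / 2) + T) := by gcongr
  have h9 : (K * G ^ 2) ^ 2 * Q ^ 2 ≤ (K * G ^ 2) ^ 2 * (4 * (t + 1) * T) := by gcongr
  linarith

end LeastSquares

section ShallowNetwork

variable {d m : ℕ}

/-- The pre-activation `⟨Wₖ, x⟩`. -/
def preact (W : Param d m) (x : Input d) (k : Fin m) : ℝ := ∑ j : Fin d, W (k, j) * x j

/-- The parameter whose `k`-th column is `a k • x`. -/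
def rowOuter (a : Fin m → ℝ) (x : Input d) : Param d m := WithLp.toLp 2 fun p => a p.1 * x p.2

/-- Gradient of the network output in the parameter. -/
noncomputable def nnetGrad (φ : ℝ → ℝ) (u : Fin m → ℝ) (W : Param d m) (x : Input d) : Param d m :=
  rowOuter (fun k => u k * deriv φ (preact W x k)) x

/-- The residual `f_W(x) - y`. -/
def nnetResid (φ : ℝ → ℝ) (u : Fin m → ℝ) (z : Input d × ℝ) (W : Param d m) : ℝ :=
  nnet φ u W z.1 - z.2

theorem preact_sub (W V : Param d m) (x : Input d) (k : Fin m) :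
    preact (W - V) x k = preact W x k - preact V x k := by
  simp [preact, sub_mul, Finset.sum_sub_distrib]

theorem sum_preact_sq_le (W : Param d m) (x : Input d) :
    ∑ k, preact W x k ^ 2 ≤ ‖x‖ ^ 2 * ‖W‖ ^ 2 := by
  rw [EuclideanSpace.real_norm_sq_eq W, Fintype.sum_prod_type, Finset.mul_sum]
  refine Finset.sum_le_sum fun k _ => ?_
  rw [EuclideanSpace.real_norm_sq_eq x, mul_comm]
  exact Finset.sum_mul_sq_le_sq_mul_sq _ _ _

theorem norm_rowOuter_sq (a : Fin m → ℝ) (x : Input d) :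
    ‖rowOuter a x‖ ^ 2 = (∑ k, a k ^ 2) * ‖x‖ ^ 2 := by
  rw [EuclideanSpace.real_norm_sq_eq, EuclideanSpace.real_norm_sq_eq, Fintype.sum_prod_type,
    Finset.sum_mul_sum]
  simp [rowOuter, mul_pow]

theorem inner_rowOuter (a : Fin m → ℝ) (x : Input d) (V : Param d m) :
    inner ℝ (rowOuter a x) V = ∑ k, a k * preact V x k := by
  rw [PiLp.inner_apply, Fintype.sum_prod_type]
  refine Finset.sum_congr rfl fun k _ => ?_
  rw [preact, Finset.mul_sum]
  refine Finset.sum_congr rfl fun j _ => ?_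
  simp [rowOuter]
  ring

theorem rowOuter_sub (a c : Fin m → ℝ) (x : Input d) :
    rowOuter a x - rowOuter c x = rowOuter (fun k => a k - c k) x := by
  ext p
  simp [rowOuter, sub_mul]

theorem hasFDerivAt_preact (x : Input d) (k : Fin m) (W : Param d m) :
    HasFDerivAt (fun W : Param d m => preact W x k)
      (∑ j, x j • (EuclideanSpace.proj (k, j) : Param d m →L[ℝ] ℝ)) W := by
  have h := (∑ j, x j • (EuclideanSpace.proj (k, j) : Param d m →L[ℝ] ℝ)).hasFDerivAt (x := W)
  convert h using 1
  ext V
  simp [preact, mul_comm]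

theorem hasGradientAt_nnet {φ : ℝ → ℝ} (hφ : Differentiable ℝ φ) (u : Fin m → ℝ) (x : Input d)
    (W : Param d m) :
    HasGradientAt (fun W : Param d m => nnet φ u W x) (nnetGrad φ u W x) W := by
  rw [hasGradientAt_iff_hasFDerivAt]
  have h : HasFDerivAt (fun W : Param d m => nnet φ u W x) (∑ k, u k • (deriv φ (preact W x k) •
      (∑ j, x j • (EuclideanSpace.proj (k, j) : Param d m →L[ℝ] ℝ)))) W := by
    refine HasFDerivAt.fun_sum fun k _ => HasFDerivAt.const_mul ?_ (u k)
    exact (hφ (preact W x k)).hasDerivAt.comp_hasFDerivAt W (hasFDerivAt_preact x k W)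
  refine h.congr_fderiv (ContinuousLinearMap.ext fun V => ?_)
  rw [InnerProductSpace.toDual_apply_apply, nnetGrad, inner_rowOuter]
  simp [preact, mul_comm, mul_assoc]

theorem hasGradientAt_empRisk {n : ℕ} {φ : ℝ → ℝ} (hφ : Differentiable ℝ φ) (u : Fin m → ℝ)
    (S : Fin n → Input d × ℝ) (W : Param d m) :
    HasGradientAt (empRisk φ u S)
      ((n : ℝ)⁻¹ • ∑ i, nnetResid φ u (S i) W • nnetGrad φ u W (S i).1) W := by
  rw [hasGradientAt_iff_hasFDerivAt]
  have h1 : ∀ i, HasFDerivAt (fun W : Param d m => sqLoss φ u W (S i))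
      (nnetResid φ u (S i) W • InnerProductSpace.toDual ℝ _ (nnetGrad φ u W (S i).1)) W := by
    intro i
    have h2 := ((hasGradientAt_nnet hφ u (S i).1 W).hasFDerivAt.sub_const (S i).2).pow 2
    have h3 := h2.const_mul (2⁻¹ : ℝ)
    refine (h3.congr_fderiv ?_).congr_of_eventuallyEq (.of_forall fun V => ?_)
    · ext V
      simp [nnetResid]
      ring
    · simp [sqLoss]; ring
  have h4 := (HasFDerivAt.fun_sum fun i (_ : i ∈ Finset.univ) => h1 i).const_mul (n : ℝ)⁻¹
  refine (h4.congr_fderiv ?_).congr_of_eventuallyEq (.of_forall fun V => ?_)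
  · ext V
    simp
  · simp [empRisk, div_eq_inv_mul]

theorem gdIter_succ_eq {n : ℕ} {φ : ℝ → ℝ} (hφ : Differentiable ℝ φ) (u : Fin m → ℝ)
    (S : Fin n → Input d × ℝ) (η : ℝ) (W0 : Param d m) (s : ℕ) :
    gdIter η (empRisk φ u S) W0 (s + 1) = lsqStep η (fun i => nnetResid φ u (S i))
      (fun i W => nnetGrad φ u W (S i).1) (gdIter η (empRisk φ u S) W0 s) := by
  rw [gdIter, (hasGradientAt_empRisk hφ u S _).gradient, lsqStep]

theorem abs_sub_le_of_abs_deriv_le {f : ℝ → ℝ} (hf : Differentiable ℝ f) {B : ℝ}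
    (hB : ∀ s, |deriv f s| ≤ B) (p q : ℝ) : |f p - f q| ≤ B * |p - q| :=
  convex_univ.norm_image_sub_le_of_norm_deriv_le (fun s _ => hf s) (fun s _ => hB s)
    (Set.mem_univ q) (Set.mem_univ p)

theorem abs_sub_sub_deriv_mul_le {f : ℝ → ℝ} (hf : Differentiable ℝ f)
    (hf' : Differentiable ℝ (deriv f)) {B : ℝ}
    (hB : ∀ s, |deriv (deriv f) s| ≤ B) (p q : ℝ) :
    |f p - f q - deriv f q * (p - q)| ≤ B * (p - q) ^ 2 := by
  have hB0 : 0 ≤ B := (abs_nonneg _).trans (hB 0)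
  have hd : ∀ s, HasDerivAt (fun s => f s - deriv f q * s) (deriv f s - deriv f q) s := by
    intro s
    simpa using (hf s).hasDerivAt.fun_sub ((hasDerivAt_id s).const_mul (deriv f q))
  have h := (convex_uIcc q p).norm_image_sub_le_of_norm_hasDerivWithin_le (C := B * |p - q|)
    (fun s _ => (hd s).hasDerivWithinAt) (fun s hs => ?_) Set.left_mem_uIcc Set.right_mem_uIcc
  · rw [← sq_abs (p - q)]
    calc _ = ‖f p - deriv f q * p - (f q - deriv f q * q)‖ := by
          rw [Real.norm_eq_abs]; congr 1; ring
      _ ≤ _ := h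
      _ = _ := by rw [Real.norm_eq_abs]; ring
  · refine (abs_sub_le_of_abs_deriv_le hf' hB s q).trans ?_
    refine mul_le_mul_of_nonneg_left ?_ hB0
    exact Set.abs_sub_left_of_mem_uIcc hs

theorem abs_nnetResid_le {φ : ℝ → ℝ} {Bφ : ℝ} (hBφ : ∀ s : ℝ, |φ s| ≤ Bφ)
    {u : Fin m → ℝ} {τ : ℝ} (hu : ∀ k, |u k| = τ) (hτ0 : 0 ≤ τ)
    {Cy : ℝ} {z : Input d × ℝ} (hzy : |z.2| ≤ Cy) (W : Param d m) :
    |nnetResid φ u z W| ≤ m * (τ * Bφ) + Cy := by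
  refine (abs_sub _ _).trans (add_le_add ?_ hzy)
  refine (Finset.abs_sum_le_sum_abs _ _).trans ?_
  refine (Finset.sum_le_card_nsmul _ _ (τ * Bφ) fun k _ => ?_).trans (by simp)
  rw [abs_mul, hu]
  gcongr
  exact hBφ _

theorem isRegularResidual_nnetResid {φ : ℝ → ℝ} {Bφ Bφ' Bφ'' : ℝ}
    (hφ : Differentiable ℝ φ) (hφ' : Differentiable ℝ (deriv φ))
    (hBφ : ∀ s : ℝ, |φ s| ≤ Bφ) (hBφ' : ∀ s : ℝ, |deriv φ s| ≤ Bφ')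
    (hBφ'' : ∀ s : ℝ, |deriv (deriv φ) s| ≤ Bφ'')
    {u : Fin m → ℝ} {τ : ℝ} (hu : ∀ k, |u k| = τ) (hτ0 : 0 ≤ τ) (hτ : m * τ ^ 2 ≤ 1)
    {Cx Cy : ℝ} (hCx : 0 ≤ Cx) {z : Input d × ℝ} (hzx : ‖z.1‖ ≤ Cx) (hzy : |z.2| ≤ Cy) :
    IsRegularResidual (Cx * Bφ') (Cx ^ 2 * (Bφ'' * τ)) (Cx ^ 2 * (Bφ'' * Bφ + Bφ'' * Cy * τ))
      (nnetResid φ u z) (fun W => nnetGrad φ u W z.1) := by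
  have hB0 : 0 ≤ Bφ := (abs_nonneg _).trans (hBφ 0)
  have hB0' : 0 ≤ Bφ' := (abs_nonneg _).trans (hBφ' 0)
  have hB0'' : 0 ≤ Bφ'' := (abs_nonneg _).trans (hBφ'' 0)
  have hu2 : ∀ k, u k ^ 2 = τ ^ 2 := fun k => by rw [← sq_abs, hu]
  have hpre : ∀ W V : Param d m, ∑ k, (preact W z.1 k - preact V z.1 k) ^ 2
      ≤ Cx ^ 2 * ‖W - V‖ ^ 2 := by
    intro W V
    simp only [← preact_sub]
    exact (sum_preact_sq_le _ _).trans (by gcongr)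
  refine ⟨fun W => ?_, fun W V => ?_, fun W V => ?_, fun W V => ?_, fun W => ?_⟩
  · refine (sq_le_sq₀ (norm_nonneg _) (by positivity)).mp ?_
    rw [nnetGrad, norm_rowOuter_sq, mul_pow, mul_comm]
    have h1 : ∑ k, (u k * deriv φ (preact W z.1 k)) ^ 2 ≤ ∑ _k : Fin m, τ ^ 2 * Bφ' ^ 2 := by
      refine Finset.sum_le_sum fun k _ => ?_
      rw [mul_pow, hu2, ← sq_abs (deriv φ _)]
      gcongr
      exact hBφ' _
    have h2 : ∑ _k : Fin m, τ ^ 2 * Bφ' ^ 2 ≤ Bφ' ^ 2 := by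
      rw [Finset.sum_const, Finset.card_univ, Fintype.card_fin, nsmul_eq_mul, ← mul_assoc]
      exact mul_le_of_le_one_left (by positivity) hτ
    gcongr
    exact h1.trans h2
  · have h1 : nnetResid φ u z W - nnetResid φ u z V - inner ℝ (nnetGrad φ u V z.1) (W - V)
        = ∑ k, u k * (φ (preact W z.1 k) - φ (preact V z.1 k)
          - deriv φ (preact V z.1 k) * (preact W z.1 k - preact V z.1 k)) := by
      rw [nnetGrad, inner_rowOuter, nnetResid, nnetResid, sub_sub_sub_cancel_right, nnet, nnet,
        ← Finset.sum_sub_distrib, ← Finset.sum_sub_distrib]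
      refine Finset.sum_congr rfl fun k _ => ?_
      rw [preact_sub]
      simp only [preact]
      ring
    rw [h1]
    calc _ ≤ ∑ k, τ * (Bφ'' * (preact W z.1 k - preact V z.1 k) ^ 2) := by
          refine (Finset.abs_sum_le_sum_abs _ _).trans (Finset.sum_le_sum fun k _ => ?_)
          rw [abs_mul, hu]
          gcongr
          exact abs_sub_sub_deriv_mul_le hφ hφ' hBφ'' _ _
      _ = Bφ'' * τ * ∑ k, (preact W z.1 k - preact V z.1 k) ^ 2 := by
          rw [Finset.mul_sum]; exact Finset.sum_congr rfl fun k _ => by ring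
      _ ≤ Bφ'' * τ * (Cx ^ 2 * ‖W - V‖ ^ 2) := by gcongr; exact hpre W V
      _ = _ := by ring
  · refine (sq_le_sq₀ (norm_nonneg _) (by positivity)).mp ?_
    simp only [nnetGrad, rowOuter_sub]
    rw [norm_rowOuter_sq]
    have h1 : ∑ k, (u k * deriv φ (preact W z.1 k) - u k * deriv φ (preact V z.1 k)) ^ 2
        ≤ (Bφ'' * τ) ^ 2 * (Cx ^ 2 * ‖W - V‖ ^ 2) := by
      calc _ ≤ ∑ k, (Bφ'' * τ) ^ 2 * (preact W z.1 k - preact V z.1 k) ^ 2 := by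
            refine Finset.sum_le_sum fun k _ => ?_
            have h2 := pow_le_pow_left₀ (abs_nonneg _) (abs_sub_le_of_abs_deriv_le hφ' hBφ''
              (preact W z.1 k) (preact V z.1 k)) 2
            rw [mul_pow, sq_abs, sq_abs] at h2
            rw [← mul_sub, mul_pow, hu2, mul_pow, mul_comm (Bφ'' ^ 2), mul_assoc]
            gcongr
        _ = (Bφ'' * τ) ^ 2 * ∑ k, (preact W z.1 k - preact V z.1 k) ^ 2 := by
            rw [Finset.mul_sum]
        _ ≤ _ := by gcongr; exact hpre W V
    calc _ ≤ ((Bφ'' * τ) ^ 2 * (Cx ^ 2 * ‖W - V‖ ^ 2)) * Cx ^ 2 := by gcongr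
      _ = _ := by ring
  · refine abs_le_of_sq_le_sq ?_ (by have := norm_nonneg (W - V); positivity)
    have h1 : nnetResid φ u z W - nnetResid φ u z V
        = ∑ k, u k * (φ (preact W z.1 k) - φ (preact V z.1 k)) := by
      rw [nnetResid, nnetResid, sub_sub_sub_cancel_right, nnet, nnet, ← Finset.sum_sub_distrib]
      simp only [preact, mul_sub]
    have h2 : ∑ k, u k ^ 2 ≤ 1 := by simpa [hu2] using hτ
    have h3 : ∑ k, (φ (preact W z.1 k) - φ (preact V z.1 k)) ^ 2
        ≤ Bφ' ^ 2 * (Cx ^ 2 * ‖W - V‖ ^ 2) := by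
      calc _ ≤ ∑ k, Bφ' ^ 2 * (preact W z.1 k - preact V z.1 k) ^ 2 := by
            refine Finset.sum_le_sum fun k _ => ?_
            rw [← mul_pow, ← sq_abs, ← sq_abs (Bφ' * _), abs_mul, abs_of_nonneg hB0']
            gcongr
            exact abs_sub_le_of_abs_deriv_le hφ hBφ' _ _
        _ = Bφ' ^ 2 * ∑ k, (preact W z.1 k - preact V z.1 k) ^ 2 := by rw [Finset.mul_sum]
        _ ≤ _ := by gcongr; exact hpre W V
    rw [h1]
    calc _ ≤ (∑ k, u k ^ 2) * ∑ k, (φ (preact W z.1 k) - φ (preact V z.1 k)) ^ 2 :=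
          Finset.sum_mul_sq_le_sq_mul_sq _ _ _
      _ ≤ 1 * (Bφ' ^ 2 * (Cx ^ 2 * ‖W - V‖ ^ 2)) := by gcongr
      _ = _ := by ring
  · have h1 : |nnetResid φ u z W| ≤ m * (τ * Bφ) + Cy := abs_nnetResid_le hBφ hu hτ0 hzy W
    calc _ ≤ (m * (τ * Bφ) + Cy) * (Cx ^ 2 * (Bφ'' * τ)) := by gcongr
      _ = Cx ^ 2 * ((m * τ ^ 2) * (Bφ'' * Bφ) + Bφ'' * Cy * τ) := by ring
      _ ≤ Cx ^ 2 * (1 * (Bφ'' * Bφ) + Bφ'' * Cy * τ) := by gcongr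
      _ = _ := by ring

theorem continuous_nnetResid {φ : ℝ → ℝ} (hφ : Continuous φ) (u : Fin m → ℝ)
    {X : Type*} [TopologicalSpace X] {z : X → Input d × ℝ} (hz : Continuous z)
    {W : X → Param d m} (hW : Continuous W) :
    Continuous fun x => nnetResid φ u (z x) (W x) := by
  unfold nnetResid nnet
  fun_prop

theorem continuous_sqLoss {φ : ℝ → ℝ} (hφ : Continuous φ) (u : Fin m → ℝ)
    {X : Type*} [TopologicalSpace X] {z : X → Input d × ℝ} (hz : Continuous z)
    {W : X → Param d m} (hW : Continuous W) :
    Continuous fun x => sqLoss φ u (W x) (z x) :=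
  ((continuous_nnetResid hφ u hz hW).pow 2).div_const 2

theorem continuous_nnetGrad {φ : ℝ → ℝ} (hφ : Continuous (deriv φ)) (u : Fin m → ℝ)
    {X : Type*} [TopologicalSpace X] {x : X → Input d} (hx : Continuous x)
    {W : X → Param d m} (hW : Continuous W) :
    Continuous fun y => nnetGrad φ u (W y) (x y) := by
  unfold nnetGrad rowOuter preact
  refine (PiLp.continuous_toLp 2 _).comp ?_
  fun_prop

theorem continuous_gdIter {n : ℕ} {φ : ℝ → ℝ} (hφ : Differentiable ℝ φ)
    (hφ' : Continuous (deriv φ)) (u : Fin m → ℝ) (η : ℝ) (W0 : Param d m) (s : ℕ) :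
    Continuous fun S : Fin n → Input d × ℝ => gdIter η (empRisk φ u S) W0 s := by
  induction s with
  | zero => exact continuous_const
  | succ s ih =>
    simp only [gdIter_succ_eq hφ, lsqStep]
    have hsum : Continuous fun S : Fin n → Input d × ℝ => ∑ i,
        nnetResid φ u (S i) (gdIter η (empRisk φ u S) W0 s)
          • nnetGrad φ u (gdIter η (empRisk φ u S) W0 s) (S i).1 := by
      refine continuous_finsetSum _ fun i _ => ?_
      exact (continuous_nnetResid hφ.continuous u (continuous_apply i) ih).smul
        (continuous_nnetGrad hφ' u (continuous_apply i).fst ih)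
    fun_prop

theorem continuous_sqLoss_gdIter {n : ℕ} {φ : ℝ → ℝ} (hφ : Differentiable ℝ φ)
    (hφ' : Continuous (deriv φ)) (u : Fin m → ℝ) (η : ℝ) (W0 : Param d m) (s : ℕ)
    {X : Type*} [TopologicalSpace X] {S : X → Fin n → Input d × ℝ} (hS : Continuous S)
    {z : X → Input d × ℝ} (hz : Continuous z) :
    Continuous fun x => sqLoss φ u (gdIter η (empRisk φ u (S x)) W0 s) (z x) := by
  have hW : Continuous fun x => gdIter η (empRisk φ u (S x)) W0 s :=
    Continuous.comp (g := fun S => gdIter η (empRisk φ u S) W0 s)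
      (continuous_gdIter hφ hφ' u η W0 s) hS
  exact continuous_sqLoss hφ.continuous u hz hW

end ShallowNetwork

section ReplaceOne

variable {Z : Type*} [MeasurableSpace Z] {n : ℕ}

/-- Exchanging one sample point with an independent copy preserves the law. -/
theorem measurePreserving_update_swap (P : Measure Z) [IsProbabilityMeasure P] (i : Fin n) :
    MeasurePreserving (fun p : (Fin n → Z) × Z => (Function.update p.1 i p.2, p.1 i))
      ((Measure.pi fun _ : Fin n => P).prod P) ((Measure.pi fun _ : Fin n => P).prod P) := by
  have hmeas : Measurable fun p : (Fin n → Z) × Z => (Function.update p.1 i p.2, p.1 i) := by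
    refine Measurable.prodMk ?_ (by fun_prop)
    refine measurable_pi_lambda _ fun j => ?_
    by_cases hj : j = i
    · subst hj; simpa using measurable_snd
    · simp only [Function.update_of_ne hj]; fun_prop
  refine ⟨hmeas, (Measure.prod_eq_generateFrom generateFrom_pi
    MeasurableSpace.generateFrom_measurableSet isPiSystem_pi
    MeasurableSpace.isPiSystem_measurableSet
    (Measure.FiniteSpanningSetsIn.pi fun _ => P.toFiniteSpanningSetsIn)
    P.toFiniteSpanningSetsIn ?_).symm⟩
  rintro _ ⟨s, hs, rfl⟩ t ht
  have hs' : ∀ j, MeasurableSet (s j) := fun j => hs j (Set.mem_univ j)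
  rw [Measure.map_apply hmeas ((MeasurableSet.univ_pi hs').prod ht)]
  have hpre : (fun p : (Fin n → Z) × Z => (Function.update p.1 i p.2, p.1 i)) ⁻¹'
      (Set.univ.pi s ×ˢ t) = Set.univ.pi (Function.update s i t) ×ˢ s i := by
    ext ⟨S, z⟩
    simp only [Set.mem_preimage, Set.mem_prod, Set.mem_univ_pi]
    constructor
    · rintro ⟨h1, h2⟩
      refine ⟨fun j => ?_, by simpa using h1 i⟩
      by_cases hj : j = i
      · subst hj; simpa using h2
      · simpa [hj] using h1 j
    · rintro ⟨h1, h2⟩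
      refine ⟨fun j => ?_, by simpa using h1 i⟩
      by_cases hj : j = i
      · subst hj; simpa using h2
      · simpa [hj] using h1 j
  rw [hpre, Measure.prod_prod, Measure.pi_pi, Measure.pi_pi,
    ← Finset.mul_prod_erase _ _ (Finset.mem_univ i),
    ← Finset.mul_prod_erase _ (fun j => P (s j)) (Finset.mem_univ i), Function.update_self]
  have : ∏ j ∈ Finset.univ.erase i, P (Function.update s i t j)
      = ∏ j ∈ Finset.univ.erase i, P (s j) :=
    Finset.prod_congr rfl fun j hj => by rw [Function.update_of_ne (Finset.ne_of_mem_erase hj)]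
  rw [this]
  ring

/-- Generalisation gap from a pointwise replace-one stability estimate. -/
theorem integral_gap_le_of_replace_one (hn : 1 ≤ n) (P : Measure Z) [IsProbabilityMeasure P]
    (F : ℕ → (Fin n → Z) → Z → ℝ) {T t : ℕ}
    (hF : ∀ j, Integrable (fun p : (Fin n → Z) × Z => F j p.1 p.2)
      ((Measure.pi fun _ : Fin n => P).prod P))
    (hFi : ∀ j i, Integrable (fun S : Fin n → Z => F j S (S i)) (Measure.pi fun _ : Fin n => P))
    {a c : ℝ} (ha : 0 ≤ a)
    (hstab : ∀ i, ∀ᵐ p ∂((Measure.pi fun _ : Fin n => P).prod P),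
      F T p.1 p.2 - F T (Function.update p.1 i p.2) p.2
        ≤ a * (2 * (t + 1) * F T (Function.update p.1 i p.2) p.2 + ∑ j ∈ Finset.range (t + 1),
            (F j p.1 (p.1 i) + F j (Function.update p.1 i p.2) p.2))
          + c * ∑ j ∈ Finset.range (t + 1),
            (F j p.1 (p.1 i) + F j (Function.update p.1 i p.2) p.2))
    (hanti : ∀ᵐ S ∂(Measure.pi fun _ : Fin n => P), ∀ j ≤ t,
      (∑ i, F T S (S i)) / n ≤ (∑ i, F j S (S i)) / n) :
    ∫ S, ((∫ z, F T S z ∂P) - (∑ i, F T S (S i)) / n) ∂(Measure.pi fun _ : Fin n => P)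
      ≤ (4 * a + 2 * c) * ∑ j ∈ Finset.range (t + 1),
          ∫ S, (∑ i, F j S (S i)) / n ∂(Measure.pi fun _ : Fin n => P) := by
  set μ := Measure.pi fun _ : Fin n => P with hμ
  have hn' : (0 : ℝ) < n := by exact_mod_cast hn
  have hfst : MeasurePreserving (Prod.fst : (Fin n → Z) × Z → _) (μ.prod P) μ :=
    measurePreserving_fst
  have hQi : ∀ j i, Integrable (fun p : (Fin n → Z) × Z => F j p.1 (p.1 i)) (μ.prod P) :=
    fun j i => hfst.integrable_comp_of_integrable (hFi j i)
  have hQi_int : ∀ j i, ∫ p, F j p.1 (p.1 i) ∂(μ.prod P) = ∫ S, F j S (S i) ∂μ := by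
    intro j i
    have h := integral_map (μ := μ.prod P) hfst.measurable.aemeasurable
      (f := fun S : Fin n → Z => F j S (S i))
      (by rw [hfst.map_eq]; exact (hFi j i).aestronglyMeasurable)
    rw [hfst.map_eq] at h
    exact h.symm
  have hQu : ∀ j i, Integrable (fun p : (Fin n → Z) × Z =>
      F j (Function.update p.1 i p.2) p.2) (μ.prod P) := by
    intro j i
    have h := (measurePreserving_update_swap P i).integrable_comp_of_integrable (hQi j i)
    simpa [Function.comp_def] using h
  have hQu_int : ∀ j i, ∫ p, F j (Function.update p.1 i p.2) p.2 ∂(μ.prod P)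
      = ∫ S, F j S (S i) ∂μ := by
    intro j i
    have hT := measurePreserving_update_swap P i
    have h := integral_map hT.measurable.aemeasurable
      (f := fun p : (Fin n → Z) × Z => F j p.1 (p.1 i))
      (by rw [hT.map_eq]; exact (hQi j i).aestronglyMeasurable)
    rw [hT.map_eq] at h
    rw [← hQi_int, hμ, h]
    simp
  set e : ℕ → Fin n → ℝ := fun j i => ∫ S, F j S (S i) ∂μ with he
  set X := ∫ p, F T p.1 p.2 ∂(μ.prod P) with hX
  have hstep : ∀ i, X - e T i ≤ a * (2 * (t + 1) * e T i + 2 * ∑ j ∈ Finset.range (t + 1), e j i)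
      + c * (2 * ∑ j ∈ Finset.range (t + 1), e j i) := by
    intro i
    have hadd : ∀ j, Integrable (fun p : (Fin n → Z) × Z =>
        F j p.1 (p.1 i) + F j (Function.update p.1 i p.2) p.2) (μ.prod P) :=
      fun j => (hQi j i).add (hQu j i)
    have hsI : Integrable (fun p : (Fin n → Z) × Z => ∑ j ∈ Finset.range (t + 1),
        (F j p.1 (p.1 i) + F j (Function.update p.1 i p.2) p.2)) (μ.prod P) :=
      integrable_finsetSum _ fun j _ => hadd j
    have hs : ∫ p, ∑ j ∈ Finset.range (t + 1),
        (F j p.1 (p.1 i) + F j (Function.update p.1 i p.2) p.2) ∂(μ.prod P)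
        = 2 * ∑ j ∈ Finset.range (t + 1), e j i := by
      rw [integral_finsetSum _ fun j _ => hadd j, Finset.mul_sum]
      refine Finset.sum_congr rfl fun j _ => ?_
      rw [integral_add (hQi j i) (hQu j i), hQi_int, hQu_int]
      ring
    have hI : Integrable (fun p : (Fin n → Z) × Z =>
        2 * ((t : ℝ) + 1) * F T (Function.update p.1 i p.2) p.2 + ∑ j ∈ Finset.range (t + 1),
          (F j p.1 (p.1 i) + F j (Function.update p.1 i p.2) p.2)) (μ.prod P) :=
      ((hQu T i).const_mul (2 * ((t : ℝ) + 1))).add hsI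
    have h1 := integral_mono_ae ((hF T).sub (hQu T i))
      ((hI.const_mul a).add (hsI.const_mul c)) (hstab i)
    simp only [Pi.sub_apply, Pi.add_apply] at h1
    rw [integral_sub (hF T) (hQu T i), hQu_int,
      integral_add (hI.const_mul a) (hsI.const_mul c), integral_const_mul, integral_const_mul,
      integral_add ((hQu T i).const_mul (2 * ((t : ℝ) + 1))) hsI, integral_const_mul, hs,
      hQu_int] at h1
    exact h1
  have havg : ∀ j, ∫ S, (∑ i, F j S (S i)) / n ∂μ = (∑ i, e j i) / n := by
    intro j
    rw [integral_div, integral_finsetSum _ fun i _ => hFi j i]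
  have hIavg : ∀ j, Integrable (fun S : Fin n → Z => (∑ i, F j S (S i)) / n) μ :=
    fun j => (integrable_finsetSum _ fun i _ => hFi j i).div_const _
  have hleft : ∫ S, ((∫ z, F T S z ∂P) - (∑ i, F T S (S i)) / n) ∂μ = X - (∑ i, e T i) / n := by
    rw [integral_sub (hF T).integral_prod_left (hIavg T), havg, hX, integral_prod _ (hF T)]
  have hdec : (t + 1) * ((∑ i, e T i) / n) ≤ ∑ j ∈ Finset.range (t + 1), (∑ i, e j i) / n := by
    have h1 : ∀ j ∈ Finset.range (t + 1), (∑ i, e T i) / n ≤ (∑ i, e j i) / n := by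
      intro j hj
      rw [← havg, ← havg]
      refine integral_mono_ae (hIavg T) (hIavg j) ?_
      filter_upwards [hanti] with S hS
      exact hS j (Nat.lt_succ_iff.mp (Finset.mem_range.mp hj))
    have h2 := Finset.card_nsmul_le_sum _ _ _ h1
    simpa using h2
  rw [hleft]
  simp only [havg]
  have hsum := Finset.sum_le_sum fun i (_ : i ∈ Finset.univ) => hstep i
  have hswap : ∑ i, ∑ j ∈ Finset.range (t + 1), e j i = n * ∑ j ∈ Finset.range (t + 1),
      (∑ i, e j i) / n := by
    rw [Finset.sum_comm, Finset.mul_sum]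
    refine Finset.sum_congr rfl fun j _ => ?_
    field_simp
  simp only [Finset.sum_sub_distrib, Finset.sum_add_distrib, ← Finset.mul_sum, Finset.sum_const,
    Finset.card_univ, Fintype.card_fin, nsmul_eq_mul] at hsum
  rw [hswap] at hsum
  set B := ∑ j ∈ Finset.range (t + 1), (∑ i, e j i) / n
  have hET : ∑ i, e T i = n * ((∑ i, e T i) / n) := by field_simp
  rw [hET] at hsum
  set eT := (∑ i, e T i) / n
  have h3 : X - eT ≤ a * (2 * (t + 1) * eT + 2 * B) + c * (2 * B) := by
    refine le_of_mul_le_mul_left ?_ hn'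
    linarith
  have h4 : a * ((t + 1) * eT) ≤ a * B := by gcongr
  linarith

end ReplaceOne

/-- The width condition makes each gradient step expansive by a factor at most `1 + 1 / (2t)`. -/
theorem width_condition_imp {m : ℕ} {η t Cx C0 B' B'' τ : ℝ} (hτ0 : 0 ≤ τ) (hτ : √(m : ℝ) * τ ≤ 1)
    (hη : 0 ≤ η) (ht : 0 ≤ t) (hC0 : 0 ≤ C0) (hCx : 0 ≤ Cx) (hB' : 0 ≤ B') (hB'' : 0 ≤ B'')
    (hm : 144 * (η * t) ^ 2 * Cx ^ 4 * C0 * B'' ^ 2 * (4 * B' * Cx * √(η * t) + √2) ^ 2 ≤ (m : ℝ)) :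
    2 * t * (η * (Cx ^ 2 * (B'' * τ) * (√(2 * C0) + 3 * (Cx * B' * √(2 * η * t * C0))))) ≤ 1 := by
  have h1 : 12 * (η * t) * Cx ^ 2 * √C0 * B'' * (4 * B' * Cx * √(η * t) + √2) ≤ √(m : ℝ) := by
    refine Real.le_sqrt_of_sq_le (le_trans (le_of_eq ?_) hm)
    simp only [mul_pow, Real.sq_sqrt hC0]
    ring
  have h2 : √(2 * C0) = √2 * √C0 := Real.sqrt_mul (by norm_num) _
  have h3 : √(2 * η * t * C0) = √2 * √(η * t) * √C0 := by
    rw [show 2 * η * t * C0 = 2 * (η * t) * C0 by ring, Real.sqrt_mul (by positivity),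
      Real.sqrt_mul (by norm_num)]
  have h4 : √2 ≤ 2 := by rw [Real.sqrt_le_left (by norm_num)]; norm_num
  rw [h2, h3]
  calc _ = (2 * (η * t) * Cx ^ 2 * √C0 * B'' * (3 * B' * Cx * √(η * t) * √2 + √2)) * τ := by ring
    _ ≤ (2 * (η * t) * Cx ^ 2 * √C0 * B'' * (3 * B' * Cx * √(η * t) * 2 + √2 * 2)) * τ := by
        gcongr
        linarith [Real.sqrt_nonneg 2]
    _ = (12 * (η * t) * Cx ^ 2 * √C0 * B'' * (B' * Cx * √(η * t) + √2 / 3)) * τ := by ring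
    _ ≤ (12 * (η * t) * Cx ^ 2 * √C0 * B'' * (4 * B' * Cx * √(η * t) + √2)) * τ := by
        have : 0 ≤ B' * Cx * √(η * t) := by positivity
        gcongr (12 * (η * t) * Cx ^ 2 * √C0 * B'' * ?_) * τ
        linarith [Real.sqrt_nonneg 2]
    _ ≤ √(m : ℝ) * τ := by gcongr
    _ ≤ 1 := hτ

theorem stability_constant_le {A η n t : ℝ} (hA : 0 ≤ A) (hη : 0 ≤ η) (hn : 0 ≤ n) (ht : 1 ≤ t) :
    4 * (Real.exp 1 * (η / n) * A) + 2 * (2 * (t + 1) * (Real.exp 1 * (η / n) * A) ^ 2)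
      ≤ 16 * Real.exp 3 * A * (1 + A) * (η / n + η ^ 2 * t / n ^ 2) := by
  have he : 1 ≤ Real.exp 1 := Real.one_le_exp (by norm_num)
  have he3 : Real.exp 3 = Real.exp 1 ^ 3 := by rw [← Real.exp_nat_mul]; norm_num
  set x := Real.exp 1
  rw [he3]
  set y := η / n with hy
  have hy0 : 0 ≤ y := by positivity
  have hyt : η ^ 2 * t / n ^ 2 = y ^ 2 * t := by rw [hy]; ring
  rw [hyt]
  have h1 : x ≤ x ^ 3 := le_self_pow₀ he (by norm_num)
  have h2 : x ^ 2 ≤ x ^ 3 := pow_le_pow_right₀ he (by norm_num)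
  have h3 : 4 * (x * y * A) ≤ 16 * x ^ 3 * A * y := by
    have : x * (y * A) ≤ x ^ 3 * (y * A) := by gcongr
    have : 0 ≤ x ^ 3 * (y * A) := by positivity
    linarith
  have h4 : 2 * (2 * (t + 1) * (x * y * A) ^ 2) ≤ 16 * x ^ 3 * A * A * (y ^ 2 * t) := by
    calc _ = 4 * (t + 1) * x ^ 2 * (y ^ 2 * A ^ 2) := by ring
      _ ≤ 4 * (t + t) * x ^ 3 * (y ^ 2 * A ^ 2) := by gcongr
      _ = 8 * (x ^ 3 * A * A * (y ^ 2 * t)) := by ring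
      _ ≤ 16 * (x ^ 3 * A * A * (y ^ 2 * t)) := by gcongr; norm_num
      _ = _ := by ring
  have h5 : 0 ≤ 16 * x ^ 3 * A * (y ^ 2 * t) := by positivity
  have h6 : 0 ≤ 16 * x ^ 3 * A * A * y := by positivity
  linarith

/-- Generalisation error of gradient descent on shallow networks. The step-size condition
`η ≤ 1 / (2ρ)` is written `2 * η * ρ ≤ 1`, so that `ρ = 0` imposes no restriction. -/
theorem statement2 {d m n : ℕ} (hn : 1 ≤ n)
    (φ : ℝ → ℝ) (Bφ Bφ' Bφ'' : ℝ)
    (hφ : Differentiable ℝ φ) (hφ' : Differentiable ℝ (deriv φ))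
    (hBφ : ∀ s : ℝ, |φ s| ≤ Bφ) (hBφ' : ∀ s : ℝ, |deriv φ s| ≤ Bφ')
    (hBφ'' : ∀ s : ℝ, |deriv (deriv φ) s| ≤ Bφ'')
    (u : Fin m → ℝ) (hu : ∀ k, u k = 1 / Real.sqrt m ∨ u k = -(1 / Real.sqrt m))
    (Cx Cy C0 : ℝ) (hCx : 0 < Cx) (hCy : 0 < Cy) (hC0 : 0 < C0)
    (P : Measure (Input d × ℝ)) [IsProbabilityMeasure P]
    (hsupp : ∀ᵐ z ∂P, ‖z.1‖ ≤ Cx ∧ |z.2| ≤ Cy)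
    (W0 : Param d m) (hloss0 : ∀ᵐ z ∂P, sqLoss φ u W0 z ≤ C0)
    (ρ : ℝ) (hρ : ρ = Cx ^ 2 * (Bφ' ^ 2 + Bφ'' * Bφ + Bφ'' * Cy / Real.sqrt m))
    (η : ℝ) (hη0 : 0 < η) (hη : 2 * η * ρ ≤ 1)
    (t : ℕ) (ht : 0 < t)
    (hm : 144 * (η * t) ^ 2 * Cx ^ 4 * C0 * Bφ'' ^ 2
        * (4 * Bφ' * Cx * Real.sqrt (η * t) + Real.sqrt 2) ^ 2 ≤ (m : ℝ))
    (b : ℝ) (hb : b = 16 * Real.exp 3 * Cx ^ 2 * Bφ' ^ 2 * (1 + Cx ^ 2 * Bφ' ^ 2)) :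
    ∫ S, (popRisk φ u P (gdIter η (empRisk φ u S) W0 (t + 1))
          - empRisk φ u S (gdIter η (empRisk φ u S) W0 (t + 1)))
        ∂(Measure.pi fun _ : Fin n => P)
      ≤ b * (η / n + η ^ 2 * t / n ^ 2)
          * ∑ j ∈ Finset.range (t + 1),
              ∫ S, empRisk φ u S (gdIter η (empRisk φ u S) W0 j)
                ∂(Measure.pi fun _ : Fin n => P) := by
  have ht' : (1 : ℝ) ≤ t := by exact_mod_cast ht
  have hB0' : 0 ≤ Bφ' := (abs_nonneg _).trans (hBφ' 0)
  have hB0 : 0 ≤ Bφ := (abs_nonneg _).trans (hBφ 0)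
  have hB0'' : 0 ≤ Bφ'' := (abs_nonneg _).trans (hBφ'' 0)
  set τ := 1 / √(m : ℝ) with hτdef
  have hτ0 : 0 ≤ τ := by positivity
  have huτ : ∀ k, |u k| = τ := by
    intro k
    rcases hu k with h | h <;> rw [h]
    · exact abs_of_nonneg hτ0
    · rw [abs_neg, abs_of_nonneg hτ0]
  have hmτ : √(m : ℝ) * τ ≤ 1 := by
    rw [hτdef, mul_one_div]
    exact div_self_le_one _
  have hmτ2 : m * τ ^ 2 ≤ 1 := by
    calc m * τ ^ 2 = (√(m : ℝ) * τ) ^ 2 := by rw [mul_pow, Real.sq_sqrt (by positivity)]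
      _ ≤ 1 := pow_le_one₀ (by positivity) hmτ
  set G := Cx * Bφ' with hG
  have hG0 : 0 ≤ G := by positivity
  set β := Cx ^ 2 * (Bφ'' * τ) with hβ
  have hβ0 : 0 ≤ β := by positivity
  set κ := Cx ^ 2 * (Bφ'' * Bφ + Bφ'' * Cy * τ) with hκ
  have hκ0 : 0 ≤ κ := by positivity
  have hηG : 2 * η * (G ^ 2 + κ) ≤ 1 := by
    refine le_of_eq_of_le ?_ hη
    rw [hρ, hG, hκ, hτdef]
    ring
  have hreg : ∀ z : Input d × ℝ, ‖z.1‖ ≤ Cx ∧ |z.2| ≤ Cy →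
      IsRegularResidual G β κ (nnetResid φ u z) (fun W => nnetGrad φ u W z.1) := fun z hz =>
    isRegularResidual_nnetResid hφ hφ' hBφ hBφ' hBφ'' huτ hτ0 hmτ2 hCx.le hz.1 hz.2
  have hwidth := width_condition_imp hτ0 hmτ hη0.le (zero_le_one.trans ht') hC0.le hCx.le hB0' hB0''
    hm
  set M := m * (τ * Bφ) + Cy
  have hbound : ∀ (W : Param d m) (z : Input d × ℝ), |z.2| ≤ Cy → ‖sqLoss φ u W z‖ ≤ M ^ 2 / 2 := by
    intro W z hz
    have h1 := abs_nnetResid_le hBφ huτ hτ0 hz W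
    have h2 : (nnet φ u W z.1 - z.2) ^ 2 ≤ M ^ 2 := by
      rw [← sq_abs]
      exact pow_le_pow_left₀ (abs_nonneg _) h1 2
    rw [sqLoss, Real.norm_of_nonneg (by positivity)]
    linarith
  set μ := Measure.pi fun _ : Fin n => P with hμ
  have hgood : ∀ᵐ z ∂P, (‖z.1‖ ≤ Cx ∧ |z.2| ≤ Cy) ∧ sqLoss φ u W0 z ≤ C0 := hsupp.and hloss0
  have hgoodS : ∀ᵐ S ∂μ, ∀ i, (‖(S i).1‖ ≤ Cx ∧ |(S i).2| ≤ Cy) ∧ sqLoss φ u W0 (S i) ≤ C0 :=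
    ae_all_iff.mpr fun i =>
      (measurePreserving_eval (fun _ : Fin n => P) i).quasiMeasurePreserving.ae hgood
  have hgoodfst := (measurePreserving_fst (μ := μ) (ν := P)).quasiMeasurePreserving.ae hgoodS
  have hgoodsnd := (measurePreserving_snd (μ := μ) (ν := P)).quasiMeasurePreserving.ae hgood
  have hA := stability_constant_le (A := G ^ 2) (sq_nonneg G) hη0.le n.cast_nonneg ht'
  have hmain := integral_gap_le_of_replace_one hn P
    (fun j S z => sqLoss φ u (gdIter η (empRisk φ u S) W0 j) z) (T := t + 1) (t := t)
    (a := Real.exp 1 * (η / n) * G ^ 2) (c := 2 * (t + 1) * (Real.exp 1 * (η / n) * G ^ 2) ^ 2)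
    (fun j => ?_) (fun j i => ?_) (by positivity) (fun i => ?_) ?_
  · refine hmain.trans (mul_le_mul_of_nonneg_right ?_ ?_)
    · refine hA.trans (le_of_eq ?_)
      rw [hb, hG]
      ring
    · refine Finset.sum_nonneg fun j _ => integral_nonneg fun S => ?_
      exact lsqRisk_nonneg (fun i => nnetResid φ u (S i)) _
  · refine Integrable.of_bound (C := M ^ 2 / 2) (Continuous.aestronglyMeasurable ?_) ?_
    · exact continuous_sqLoss_gdIter hφ hφ'.continuous u η W0 j continuous_fst continuous_snd
    · filter_upwards [hgoodsnd] with p hp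
      exact hbound _ _ hp.1.2
  · refine Integrable.of_bound (C := M ^ 2 / 2) (Continuous.aestronglyMeasurable ?_) ?_
    · exact continuous_sqLoss_gdIter hφ hφ'.continuous u η W0 j continuous_id (continuous_apply i)
    · filter_upwards [hgoodS] with S hS
      exact hbound _ _ (hS i).1.2
  · filter_upwards [hgoodfst, hgoodsnd] with p hp1 hp2
    obtain ⟨S, z⟩ := p
    dsimp only at hp1 hp2 ⊢
    have hupd : ∀ j, (‖(Function.update S i z j).1‖ ≤ Cx ∧ |(Function.update S i z j).2| ≤ Cy)
        ∧ sqLoss φ u W0 (Function.update S i z j) ≤ C0 := by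
      intro j
      by_cases hj : j = i
      · subst hj; simpa using hp2
      · simpa [hj] using hp1 j
    have hD := norm_lsq_iterate_sub_le hn hη0 hκ0 hηG hβ0 (fun j => hreg _ (hp1 j).1)
      (fun j => hreg _ (hupd j).1) i (fun j hj => by rw [Function.update_of_ne hj])
      (fun j hj => by rw [Function.update_of_ne hj])
      (gdIter_succ_eq hφ u S η W0) (gdIter_succ_eq hφ u (Function.update S i z) η W0) rfl
      (fun j => (hp1 j).2) (fun j => (hupd j).2) ht hwidth
    have hlip := (hreg z hp2.1).lipschitz (gdIter η (empRisk φ u S) W0 (t + 1))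
      (gdIter η (empRisk φ u (Function.update S i z)) W0 (t + 1))
    simp only [Function.update_self] at hD
    refine half_sq_sub_half_sq_le
      (fun j => nnetResid φ u (S i) (gdIter η (empRisk φ u S) W0 j))
      (fun j => nnetResid φ u z (gdIter η (empRisk φ u (Function.update S i z)) W0 j))
      hG0 (by positivity) hlip (hD.trans_eq ?_)
    ring
  · filter_upwards [hgoodS] with S hS j hj
    have h := lsqRisk_antitone hn hη0 hηG (fun i => hreg (S i) (hS i).1)
      (w := gdIter η (empRisk φ u S) W0) (gdIter_succ_eq hφ u S η W0) (show j ≤ t + 1 by omega)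
    exact h
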